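/- Let θ be a congruence on an inverse semigroup S. The canonical homomorphism π: S → Ω(S,θ), s ↦ π_s, embeds the normal extension (S,θ) into the normal extension (Ω(S,θ), Ω(θ)); that is, π is injective, π(Ker θ) ⊆ Ker Ω(θ), and s θ s' holds if and only if π_s Ω(θ) π_{s'} holds. Moreover, the map ι: S/θ → Ω(S,θ)/Ω(θ), θ(s) ↦ Ω(θ)(π_s), is an isomorphism. -/

import Mathlib

/-- An inverse semigroup: a semigroup in which every element `a` has a unique
inverse `a⁻¹` satisfying `a * a⁻¹ * a = a` and `a⁻¹ * a * a⁻¹ = a⁻¹`. -/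
class InverseSemigroup (S : Type*) extends Semigroup S, Inv S where
  mul_inv_mul : ∀ a : S, a * a⁻¹ * a = a
  inv_mul_inv : ∀ a : S, a⁻¹ * a * a⁻¹ = a⁻¹
  inv_unique : ∀ {a b : S}, a * b * a = a → b * a * b = b → b = a⁻¹

/-- A bitranslation of a semigroup `S`: a linked pair `(l, r)` of a left
translation and a right translation, written `ω s := l s`, `s ω := r s`. -/
@[ext]
structure Bitrans (S : Type*) [Mul S] where
  l : S → S
  r : S → S
  l_mul : ∀ s t : S, l (s * t) = l s * t
  r_mul : ∀ s t : S, r (s * t) = s * r t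
  linked : ∀ s t : S, s * l t = r s * t

namespace Bitrans

variable {S : Type*} [Mul S]

/-- Product of bitranslations: `(ωω')s = ω(ω's)` and `s(ωω') = (sω)ω'`. -/
instance : Mul (Bitrans S) where
  mul ω ω' :=
    { l := fun s => ω.l (ω'.l s)
      r := fun s => ω'.r (ω.r s)
      l_mul := fun s t => by
        show ω.l (ω'.l (s * t)) = ω.l (ω'.l s) * t
        rw [ω'.l_mul, ω.l_mul]
      r_mul := fun s t => by
        show ω'.r (ω.r (s * t)) = s * ω'.r (ω.r t)
        rw [ω.r_mul, ω'.r_mul]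
      linked := fun s t => by
        show s * ω.l (ω'.l t) = ω'.r (ω.r s) * t
        rw [ω.linked, ω'.linked] }

/-- The translational hull `Ω(S)` (all bitranslations) is a semigroup. -/
instance : Semigroup (Bitrans S) where
  mul_assoc a b c := by ext s <;> rfl

end Bitrans

/-- The inner bitranslation `π_s` induced by `s`. -/
def innerBitrans {S : Type*} [Semigroup S] (s : S) : Bitrans S where
  l := fun x => s * x
  r := fun x => x * s
  l_mul := fun x y => (mul_assoc s x y).symm
  r_mul := fun x y => mul_assoc x y s
  linked := fun x y => (mul_assoc x s y).symm

/-- `Π(S)`, the set of inner bitranslations of `S`. -/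
def innerSet (S : Type*) [Semigroup S] : Set (Bitrans S) :=
  Set.range (innerBitrans (S := S))

/-- A bitranslation of `S` respects the congruence `θ`. -/
def RespectsCon {S : Type*} [Mul S] (θ : Con S) (ω : Bitrans S) : Prop :=
  ∀ a b : S, θ a b → θ (ω.l a) (ω.l b) ∧ θ (ω.r a) (ω.r b)

/-- The bitranslation of `S/θ` induced by `ω` is the inner bitranslation
induced by some `u ∈ S/θ`. -/
def InducedInnerCon {S : Type*} [Mul S] (θ : Con S) (ω : Bitrans S) : Prop :=
  ∃ u : θ.Quotient, ∀ s : S,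
    ((ω.l s : S) : θ.Quotient) = u * (s : θ.Quotient) ∧
    ((ω.r s : S) : θ.Quotient) = (s : θ.Quotient) * u

/-- The translational hull `Ω(S, θ)` of the normal extension `(S, θ)`: all
bitranslations of `S` respecting `θ` whose induced bitranslation on `S/θ`
is inner. -/
def OmegaNE {S : Type*} [Mul S] (θ : Con S) : Set (Bitrans S) :=
  {ω | RespectsCon θ ω ∧ InducedInnerCon θ ω}

/-- The congruence `Ω(θ)` on `Ω(S, θ)`: `ω Ω(θ) ω'` iff `ωs θ ω's` and
`sω θ sω'` for every `s ∈ S`. -/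
def OmegaCon {S : Type*} [Mul S] (θ : Con S) (ω ω' : Bitrans S) : Prop :=
  ∀ s : S, θ (ω.l s) (ω'.l s) ∧ θ (ω.r s) (ω'.r s)

/-- The Kernel of the congruence `θ`: all elements `θ`-related to an
idempotent. -/
def KerCon {S : Type*} [Mul S] (θ : Con S) : Set S :=
  {s | ∃ e : S, e * e = e ∧ θ s e}

/-- The Kernel of the congruence `Ω(θ)` on `Ω(S, θ)`: all elements of
`Ω(S, θ)` that are `Ω(θ)`-related to an idempotent of `Ω(S, θ)`. -/
def KerOmegaCon {S : Type*} [Mul S] (θ : Con S) : Set (Bitrans S) :=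
  {ω | ω ∈ OmegaNE θ ∧ ∃ ω' ∈ OmegaNE θ, ω' * ω' = ω' ∧ OmegaCon θ ω ω'}

/-- For a congruence `θ` on an inverse semigroup `S`, the
canonical homomorphism `π : S → Ω(S,θ)`, `s ↦ π_s`, embeds the normal
extension `(S, θ)` into the normal extension `(Ω(S,θ), Ω(θ))`: `π` is an
injective homomorphism into `Ω(S,θ)`, `π(Ker θ) ⊆ Ker Ω(θ)`, and `s θ s'`
holds iff `π_s Ω(θ) π_{s'}` holds.  Moreover the induced map
`ι : S/θ → Ω(S,θ)/Ω(θ)`, `θ(s) ↦ Ω(θ)(π_s)`, is an isomorphism (it is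
well defined and injective by the previous property, surjective and
multiplicative by the last two properties). -/
theorem canonical_hom_embeds_normal_extension {S : Type*}
    [InverseSemigroup S] (θ : Con S) :
    -- `π` is injective
    Function.Injective (innerBitrans (S := S)) ∧
    -- `π` maps `S` into `Ω(S, θ)`
    (∀ s : S, innerBitrans s ∈ OmegaNE θ) ∧
    -- `π` is a homomorphism
    (∀ s s' : S, innerBitrans (s * s') = innerBitrans s * innerBitrans s') ∧
    -- `π (Ker θ) ⊆ Ker Ω(θ)`
    (∀ s ∈ KerCon θ, innerBitrans s ∈ KerOmegaCon θ) ∧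
    -- `s θ s'` iff `π_s Ω(θ) π_{s'}`
    (∀ s s' : S, θ s s' ↔ OmegaCon θ (innerBitrans s) (innerBitrans s')) ∧
    -- `ι` is surjective: every `Ω(θ)`-class of `Ω(S,θ)` contains some `π_s`
    (∀ ω ∈ OmegaNE θ, ∃ s : S, OmegaCon θ ω (innerBitrans s)) := by
  have hom : ∀ s s' : S, innerBitrans (s * s') = innerBitrans s * innerBitrans s' := by
    intro s s'
    ext x
    · exact mul_assoc s s' x
    · exact (mul_assoc x s s').symm
  have mem : ∀ s : S, innerBitrans s ∈ OmegaNE θ := by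
    intro s
    refine ⟨fun a b h => ⟨θ.mul (θ.refl s) h, θ.mul h (θ.refl s)⟩, (s : θ.Quotient), fun x => ?_⟩
    exact ⟨rfl, rfl⟩
  have fwd : ∀ s s' : S, θ s s' → OmegaCon θ (innerBitrans s) (innerBitrans s') :=
    fun s s' h x => ⟨θ.mul h (θ.refl x), θ.mul (θ.refl x) h⟩
  -- a regular semigroup modulo a congruence is weakly reductive
  have bwd : ∀ (τ : Con S) (s s' : S),
      OmegaCon τ (innerBitrans s) (innerBitrans s') → τ s s' := by
    intro τ s s' h
    have h1 : τ (s * (s'⁻¹ * s')) s' := by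
      have := (h (s'⁻¹ * s')).1
      change τ (s * (s'⁻¹ * s')) (s' * (s'⁻¹ * s')) at this
      rwa [← mul_assoc s' s'⁻¹ s', InverseSemigroup.mul_inv_mul] at this
    have h2 : τ s (s * s⁻¹ * s') := by
      have := (h (s * s⁻¹)).2
      change τ (s * s⁻¹ * s) (s * s⁻¹ * s') at this
      rwa [InverseSemigroup.mul_inv_mul] at this
    have h3 : τ (s * (s'⁻¹ * s')) (s * s⁻¹ * s') := by
      have := τ.mul (τ.refl (s * s⁻¹)) h1
      rwa [← mul_assoc (s * s⁻¹) s, InverseSemigroup.mul_inv_mul] at this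
    exact τ.trans h2 (τ.trans (τ.symm h3) h1)
  refine ⟨?_, mem, hom, ?_, fun s s' => ⟨fwd s s', bwd θ s s'⟩, ?_⟩
  · intro s s' h
    have := bwd ⊥ s s' (by rw [h]; exact fun x => ⟨Con.refl _ _, Con.refl _ _⟩)
    exact this
  · rintro s ⟨e, he, hse⟩
    exact ⟨mem s, innerBitrans e, mem e, by rw [← hom, he], fwd s e hse⟩
  · rintro ω ⟨-, u, hu⟩
    induction u using Con.induction_on with
    | _ s =>
      exact ⟨s, fun x => ⟨(Con.eq θ).1 (hu x).1, (Con.eq θ).1 (hu x).2⟩⟩
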